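/- Suppose X is a Markov chain with transition kernel K ∈ D(G), let γ be a uniform extremal boundary for K, let m ≥ 1, and let ρ(x,y) = max_{1≤j≤m} |x_j − y_j| on ℝ^m. If γ ≡ 0 is an extremal boundary for K, or if K satisfies the regularity condition, then for every ε > 0 and every nonnegative function u_t → u > 0: P_{tu_t}[ρ((X_1^{(t)}, …, X_m^{(t)})/t, (X_1, …, X_m)/t) > ε] → 0 as t → ∞, and consequently P_{tu_t}[(X_1/t, …, X_m/t) ∈ ·] converges weakly on [0,∞]^m to P_u[(T*_1, …, T*_m) ∈ ·]. -/

import Mathlib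

open MeasureTheory ProbabilityTheory Filter Topology
open scoped NNReal ENNReal

noncomputable section

/-- `K ∈ D(G)`: the transition kernel `K` is in the domain of attraction of `G`, i.e.
`K(t, t·)` converges weakly to `G` on the compactified half-line `[0,∞]` as `t → ∞`. -/
def KernelDOA (K : Kernel ℝ≥0 ℝ≥0) (G : Measure ℝ≥0) : Prop :=
  ∀ f : C(ℝ≥0∞, ℝ),
    Tendsto (fun t : ℝ≥0 => ∫ x, f ((x / t : ℝ≥0) : ℝ≥0∞) ∂(K t))
      atTop (𝓝 (∫ x, f (x : ℝ≥0∞) ∂G))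

/-- An extremal boundary for `K` (relative to `G`): `γ(t) → 0` and
`K(t, t[0,γ(t)]) → G({0})` as `t → ∞`. -/
def ExtremalBoundary (K : Kernel ℝ≥0 ℝ≥0) (G : Measure ℝ≥0) (γ : ℝ≥0 → ℝ≥0) : Prop :=
  Tendsto γ atTop (𝓝 0) ∧
    Tendsto (fun t : ℝ≥0 => (K t) (Set.Iic (t * γ t))) atTop (𝓝 (G {0}))

/-- A uniform extremal boundary for `K` (relative to `G`): `γ(t) → 0` and
`K(t u_t, t[0,γ(t)]) → G({0})` for every nonnegative `u_t → u > 0`. -/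
def UniformExtremalBoundary (K : Kernel ℝ≥0 ℝ≥0) (G : Measure ℝ≥0)
    (γ : ℝ≥0 → ℝ≥0) : Prop :=
  Tendsto γ atTop (𝓝 0) ∧
    ∀ (u : ℝ≥0) (ut : ℝ≥0 → ℝ≥0), 0 < u → Tendsto ut atTop (𝓝 u) →
      Tendsto (fun t : ℝ≥0 => (K (t * ut t)) (Set.Iic (t * γ t))) atTop (𝓝 (G {0}))

/-- The regularity condition: `K(t u_t, t·)` converges weakly on `[0,∞]` to the point
mass `δ_0` as `t → ∞`, for every nonnegative function `u_t → 0`. -/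
def RegCond (K : Kernel ℝ≥0 ℝ≥0) : Prop :=
  ∀ u : ℝ≥0 → ℝ≥0, Tendsto u atTop (𝓝 0) →
    ∀ f : C(ℝ≥0∞, ℝ),
      Tendsto (fun t : ℝ≥0 => ∫ x, f ((x / t : ℝ≥0) : ℝ≥0∞) ∂(K (t * u t)))
        atTop (𝓝 (f 0))

/-- The law of `(X_1, …, X_m)` for the Markov chain with transition kernel `K`
started from `X_0 = y`. -/
def jointLaw (K : Kernel ℝ≥0 ℝ≥0) : (m : ℕ) → ℝ≥0 → Measure (Fin m → ℝ≥0)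
  | 0, _ => Measure.dirac (fun i => i.elim0)
  | m + 1, y => (K y).bind (fun x1 => (jointLaw K m x1).map (Fin.cons x1))

/-- The law of `(T*_1, …, T*_m)` for the tail chain associated with `(G, δ_0)`
started from `T*_0 = u`: `T*_n = u ξ_1 ⋯ ξ_n` with `ξ_i` i.i.d. of law `G`. -/
def tailChainLaw (G : Measure ℝ≥0) [IsProbabilityMeasure G] (m : ℕ) (u : ℝ≥0) :
    Measure (Fin m → ℝ≥0) :=
  (Measure.pi fun _ : Fin m => G).map
    (fun ξ (i : Fin m) => u * ∏ j ∈ Finset.Iic i, ξ j)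

/-- The extremal component at time `i ∈ {1,…,m}` of a trajectory starting at `x0` with
subsequent states `x`, relative to the threshold `c = t·γ(t)`. -/
def ecMap (m : ℕ) (c x0 : ℝ≥0) (x : Fin m → ℝ≥0) (i : Fin m) : ℝ≥0 :=
  haveI := Classical.propDecidable (c < x0 ∧ ∀ j : Fin m, j ≤ i → c < x j)
  if c < x0 ∧ ∀ j : Fin m, j ≤ i → c < x j then x i else 0

/-- A continuous convergence theorem: if `X i` converges weakly to `μ` (tested against compactly
supported functions), and `H i` is close to `H₀ w` when `X i` is near `w`, off events of
vanishing probability, then the expectations of `H i` converge to `∫ H₀ dμ`. -/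
theorem tendsto_integral_of_continuous_convergence {ι Ω : Type*} [MeasurableSpace Ω]
    {l : Filter ι} (P : ι → Measure Ω) [∀ i, IsProbabilityMeasure (P i)] (X : ι → Ω → ℝ≥0)
    (hX : ∀ i, Measurable (X i)) (μ : Measure ℝ≥0) [IsProbabilityMeasure μ]
    (hconv : ∀ g : ℝ≥0 → ℝ, Continuous g → HasCompactSupport g →
      Tendsto (fun i => ∫ ω, g (X i ω) ∂(P i)) l (𝓝 (∫ x, g x ∂μ)))
    (H : ι → Ω → ℝ) (hHm : ∀ i, AEStronglyMeasurable (H i) (P i))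
    (H₀ : ℝ≥0 → ℝ) (hH₀ : Continuous H₀) (M : ℝ)
    (hHM : ∀ i ω, |H i ω| ≤ M) (hH₀M : ∀ x, |H₀ x| ≤ M)
    (hloc : ∀ η : ℝ, 0 < η → ∃ B : ι → Set Ω, Tendsto (fun i => P i (B i)) l (𝓝 0) ∧
      ∀ w₀ : ℝ≥0, ∀ᶠ p : ι × ℝ≥0 in l ×ˢ 𝓝 w₀, ∀ ω, X p.1 ω = p.2 → ω ∉ B p.1 →
        |H p.1 ω - H₀ w₀| ≤ η) :
    Tendsto (fun i => ∫ ω, H i ω ∂(P i)) l (𝓝 (∫ x, H₀ x ∂μ)) := by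
  have hM : 0 ≤ M := (abs_nonneg _).trans (hH₀M 0)
  rw [Metric.tendsto_nhds]
  intro ε hε
  obtain ⟨η, hη, hηε⟩ : ∃ η : ℝ, 0 < η ∧ (3 + 4 * M) * η < ε := by
    refine ⟨ε / (4 + 4 * M), by positivity, ?_⟩
    rw [mul_div_assoc', div_lt_iff₀ (by positivity)]
    nlinarith
  let χ : ℕ → ℝ≥0 → ℝ := fun n x => max 0 (min 1 ((n : ℝ) + 1 - x))
  have hχc : ∀ n, Continuous (χ n) := fun n => by fun_prop
  have hχ0 : ∀ n x, 0 ≤ χ n x := fun n x => le_max_left _ _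
  have hχ1 : ∀ n x, χ n x ≤ 1 := fun n x => max_le zero_le_one (min_le_left _ _)
  have hHχM : ∀ n x, |H₀ x * χ n x| ≤ M := fun n x => by
    rw [abs_mul, abs_of_nonneg (hχ0 n _)]
    exact (mul_le_of_le_one_right (abs_nonneg _) (hχ1 n _)).trans (hH₀M _)
  have hχK : ∀ (n : ℕ) (x : ℝ≥0), x ∉ Set.Icc (0 : ℝ≥0) ((n : ℝ≥0) + 1) → χ n x = 0 := by
    intro n x hx
    have h1 : (n : ℝ≥0) + 1 < x := by simpa using hx
    have h2 : (n : ℝ) + 1 < x := by exact_mod_cast h1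
    exact max_eq_left ((min_le_right _ _).trans (by linarith))
  have hχs : ∀ n, HasCompactSupport (χ n) := fun n =>
    HasCompactSupport.intro isCompact_Icc (hχK n)
  have hχlim : Tendsto (fun n => ∫ x, χ n x ∂μ) atTop (𝓝 1) := by
    have : (1 : ℝ) = ∫ x : ℝ≥0, (1 : ℝ) ∂μ := by simp
    rw [this]
    refine tendsto_integral_of_dominated_convergence (fun _ => 1)
      (fun n => (hχc n).aestronglyMeasurable) (integrable_const _)
      (fun n => ae_of_all _ fun x => by
        rw [Real.norm_eq_abs, abs_of_nonneg (hχ0 n x)]; exact hχ1 n x) (ae_of_all _ fun x => ?_)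
    obtain ⟨N, hN⟩ := exists_nat_ge (x : ℝ)
    refine tendsto_const_nhds.congr' ?_
    filter_upwards [eventually_ge_atTop N] with n hn
    have : (N : ℝ) ≤ n := by exact_mod_cast hn
    simp only [χ]
    rw [min_eq_left (by linarith), max_eq_right zero_le_one]
  obtain ⟨n, hn⟩ := (hχlim.eventually (lt_mem_nhds (show 1 - η < 1 by linarith))).exists
  obtain ⟨B, hB, hBloc⟩ := hloc (η / 2) (by positivity)
  have hunif : ∀ᶠ i in l, ∀ ω, X i ω ∈ Set.Icc (0 : ℝ≥0) ((n : ℝ≥0) + 1) → ω ∉ B i →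
      |H i ω - H₀ (X i ω)| ≤ η := by
    have key : {p : ι × ℝ≥0 | ∀ ω, X p.1 ω = p.2 → ω ∉ B p.1 → |H p.1 ω - H₀ p.2| ≤ η} ∈
        l ×ˢ 𝓝ˢ (Set.Icc (0 : ℝ≥0) ((n : ℝ≥0) + 1)) := by
      refine isCompact_Icc.mem_prod_nhdsSet_of_forall fun w₀ _ => ?_
      have hcont : ∀ᶠ p : ι × ℝ≥0 in l ×ˢ 𝓝 w₀, |H₀ p.2 - H₀ w₀| < η / 2 := by
        have := (hH₀.tendsto w₀).comp (tendsto_snd (f := l) (g := 𝓝 w₀))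
        have := (Metric.tendsto_nhds.1 this) (η / 2) (by positivity)
        simpa [Real.dist_eq] using this
      filter_upwards [hBloc w₀, hcont] with p h1 h2 ω hω hB
      have := abs_sub_le (H p.1 ω) (H₀ w₀) (H₀ p.2)
      rw [abs_sub_comm (H₀ w₀)] at this
      linarith [h1 ω hω hB]
    obtain ⟨s, hs, t, ht, hst⟩ := Filter.mem_prod_iff.1 key
    filter_upwards [hs] with i hi ω hω hB
    exact hst (Set.mk_mem_prod hi (subset_of_mem_nhdsSet ht hω)) ω rfl hB
  have hlimχ := hconv (χ n) (hχc n) (hχs n)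
  have hlimH := hconv (fun x => H₀ x * χ n x) (hH₀.mul (hχc n)) ((hχs n).mul_left)
  have hB' : ∀ᶠ i in l, (P i).real (B i) < η := by
    have : Tendsto (fun i => (P i).real (B i)) l (𝓝 0) := by
      exact (ENNReal.tendsto_toReal ENNReal.zero_ne_top).comp hB
    exact this.eventually (gt_mem_nhds hη)
  have hintχμ : Integrable (χ n) μ := Integrable.of_bound (hχc n).aestronglyMeasurable 1
    (ae_of_all _ fun x => by rw [Real.norm_eq_abs, abs_of_nonneg (hχ0 n x)]; exact hχ1 n x)
  have hintHμ : Integrable H₀ μ := Integrable.of_bound hH₀.aestronglyMeasurable M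
    (ae_of_all _ hH₀M)
  have hpw : ∀ x, |H₀ x - H₀ x * χ n x| ≤ M * (1 - χ n x) := fun x => by
    rw [← mul_one_sub, abs_mul, abs_of_nonneg (sub_nonneg.2 (hχ1 n x))]
    exact mul_le_mul_of_nonneg_right (hH₀M x) (sub_nonneg.2 (hχ1 n x))
  have hμ : |∫ x, H₀ x * χ n x ∂μ - ∫ x, H₀ x ∂μ| ≤ M * η := by
    have hint : Integrable (fun x => H₀ x * χ n x) μ :=
      Integrable.of_bound (hH₀.mul (hχc n)).aestronglyMeasurable M (ae_of_all _ (hHχM n))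
    have hint' : Integrable (fun x => M * (1 - χ n x)) μ :=
      ((integrable_const _).sub hintχμ).const_mul M
    rw [abs_sub_comm, ← integral_sub hintHμ hint]
    calc ‖∫ x, (H₀ x - H₀ x * χ n x) ∂μ‖ ≤ ∫ x, M * (1 - χ n x) ∂μ :=
          norm_integral_le_of_norm_le hint' (ae_of_all _ hpw)
      _ = M * (1 - ∫ x, χ n x ∂μ) := by
          rw [integral_const_mul, integral_sub (integrable_const _) hintχμ]; simp
      _ ≤ M * η := mul_le_mul_of_nonneg_left (by linarith) hM
  filter_upwards [hunif, hB', hlimχ.eventually (lt_mem_nhds hn),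
    Metric.tendsto_nhds.1 hlimH η hη] with i h1 h2 h3 h4
  rw [Real.dist_eq] at h4 ⊢
  have hiχ : Integrable (fun ω => χ n (X i ω)) (P i) :=
    Integrable.of_bound ((hχc n).measurable.comp (hX i)).aestronglyMeasurable 1
      (ae_of_all _ fun x => by rw [Real.norm_eq_abs, abs_of_nonneg (hχ0 n _)]; exact hχ1 n _)
  have hiH : Integrable (H i) (P i) := Integrable.of_bound (hHm i) M (ae_of_all _ (hHM i))
  have hiHχ : Integrable (fun ω => H₀ (X i ω) * χ n (X i ω)) (P i) :=
    Integrable.of_bound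
      ((hH₀.mul (hχc n)).measurable.comp (hX i)).aestronglyMeasurable M
      (ae_of_all _ fun ω => hHχM n (X i ω))
  let S := toMeasurable (P i) (B i)
  have hS : MeasurableSet S := measurableSet_toMeasurable _ _
  have hiS : Integrable (S.indicator fun _ => 2 * M) (P i) := (integrable_const _).indicator hS
  have hi1 : Integrable (fun ω => M * (1 - χ n (X i ω))) (P i) :=
    ((integrable_const _).sub hiχ).const_mul M
  have hi2 : Integrable (fun ω => η + S.indicator (fun _ => 2 * M) ω) (P i) :=
    (integrable_const _).add hiS
  have hi3 : Integrable (fun ω => η + S.indicator (fun _ => 2 * M) ω + M * (1 - χ n (X i ω)))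
      (P i) := hi2.add hi1
  have hmain : |∫ ω, H i ω ∂(P i) - ∫ ω, H₀ (X i ω) * χ n (X i ω) ∂(P i)| ≤
      η + 2 * M * η + M * η := by
    rw [← integral_sub hiH hiHχ]
    calc ‖∫ ω, (H i ω - H₀ (X i ω) * χ n (X i ω)) ∂(P i)‖
        ≤ ∫ ω, (η + S.indicator (fun _ => 2 * M) ω + M * (1 - χ n (X i ω))) ∂(P i) := by
          refine norm_integral_le_of_norm_le hi3 (ae_of_all _ fun ω => ?_)
          rw [Real.norm_eq_abs]
          have e0 : 0 ≤ M * (1 - χ n (X i ω)) := mul_nonneg hM (sub_nonneg.2 (hχ1 n _))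
          have e1 : 0 ≤ S.indicator (fun _ => 2 * M) ω :=
            Set.indicator_nonneg (fun _ _ => by positivity) _
          have e2 := abs_sub_le (H i ω) (H₀ (X i ω)) (H₀ (X i ω) * χ n (X i ω))
          have e3 := hpw (X i ω)
          by_cases hωB : ω ∈ B i
          · rw [Set.indicator_of_mem (subset_toMeasurable _ _ hωB)]
            have := abs_sub (H i ω) (H₀ (X i ω))
            linarith [hHM i ω, hH₀M (X i ω)]
          · by_cases hω : X i ω ∈ Set.Icc (0 : ℝ≥0) ((n : ℝ≥0) + 1)
            · linarith [h1 ω hω hωB]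
            · rw [hχK n _ hω] at e0 ⊢
              rw [mul_zero, sub_zero]
              linarith [hHM i ω]
      _ = η + 2 * M * (P i).real S + M * (1 - ∫ ω, χ n (X i ω) ∂(P i)) := by
          rw [integral_add hi2 hi1, integral_add (integrable_const _) hiS,
            integral_const_mul, integral_sub (integrable_const _) hiχ, integral_indicator_const _ hS]
          simp [mul_comm]
      _ ≤ η + 2 * M * η + M * η := by
          have : (P i).real S = (P i).real (B i) := by
            simp [Measure.real, S, measure_toMeasurable]
          rw [this]
          gcongr
          linarith
  have t1 := abs_sub_le (∫ ω, H i ω ∂(P i)) (∫ ω, H₀ (X i ω) * χ n (X i ω) ∂(P i))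
    (∫ x, H₀ x * χ n x ∂μ)
  have t2 := abs_sub_le (∫ ω, H i ω ∂(P i)) (∫ x, H₀ x * χ n x ∂μ) (∫ x, H₀ x ∂μ)
  nlinarith

theorem exists_continuousMap_eq_of_hasCompactSupport (g : ℝ≥0 → ℝ) (hg : Continuous g)
    (hs : HasCompactSupport g) : ∃ f : C(ℝ≥0∞, ℝ), ∀ x : ℝ≥0, f x = g x := by
  classical
  obtain ⟨b, hb⟩ := hs.isCompact.bddAbove
  have hgb : ∀ x, b < x → g x = 0 := fun x hx => by
    by_contra h
    exact absurd (hb (subset_tsupport _ h)) (not_le.2 hx)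
  suffices hc : Continuous fun x : ℝ≥0∞ => if x = ⊤ then 0 else g x.toNNReal from
    ⟨⟨_, hc⟩, fun x => by simp⟩
  rw [continuous_iff_continuousAt]
  intro x
  by_cases hx : x = ⊤
  · subst hx
    rw [ContinuousAt, if_pos rfl]
    refine tendsto_const_nhds.congr' ?_
    filter_upwards [lt_mem_nhds (ENNReal.coe_lt_top (r := b))] with y hy
    split_ifs with h
    · rfl
    · lift y to ℝ≥0 using h
      exact (hgb _ (by simpa using hy)).symm
  · have : ContinuousAt (fun y : ℝ≥0∞ => g y.toNNReal) x :=
      hg.continuousAt.comp (ENNReal.tendsto_toNNReal hx)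
    refine this.congr ?_
    filter_upwards [isOpen_ne.mem_nhds hx] with y hy
    simp [hy]

section JointLaw

variable (K : Kernel ℝ≥0 ℝ≥0)

/-- The kernel `x ↦ δ_x ⊗ κ(x)` viewed as a kernel into `ℝ≥0^(m+1)`. -/
def consKernel {m : ℕ} (κ : Kernel ℝ≥0 (Fin m → ℝ≥0)) : Kernel ℝ≥0 (Fin (m + 1) → ℝ≥0) :=
  (Kernel.id ×ₖ κ).map fun p => Fin.cons p.1 p.2

theorem measurable_finCons_uncurry (m : ℕ) :
    Measurable fun p : ℝ≥0 × (Fin m → ℝ≥0) => (Fin.cons p.1 p.2 : Fin (m + 1) → ℝ≥0) := by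
  refine measurable_pi_iff.2 fun i => ?_
  refine Fin.cases ?_ (fun j => ?_) i
  · simpa using measurable_fst
  · simp only [Fin.cons_succ]
    exact (measurable_pi_apply j).comp measurable_snd

theorem measurable_finCons (m : ℕ) (x : ℝ≥0) :
    Measurable fun p : Fin m → ℝ≥0 => (Fin.cons x p : Fin (m + 1) → ℝ≥0) :=
  (measurable_finCons_uncurry m).comp measurable_prodMk_left

instance {m : ℕ} (κ : Kernel ℝ≥0 (Fin m → ℝ≥0)) [IsMarkovKernel κ] :
    IsMarkovKernel (consKernel κ) :=
  Kernel.IsMarkovKernel.map _ (measurable_finCons_uncurry m)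

theorem consKernel_apply {m : ℕ} (κ : Kernel ℝ≥0 (Fin m → ℝ≥0)) [IsMarkovKernel κ] (x : ℝ≥0) :
    consKernel κ x = (κ x).map (Fin.cons x) := by
  rw [consKernel, Kernel.map_apply _ (measurable_finCons_uncurry m), Kernel.prod_apply,
    Kernel.id_apply, Measure.dirac_prod,
    Measure.map_map (measurable_finCons_uncurry m) measurable_prodMk_left]
  rfl

theorem jointLaw_succ_eq_comp {m : ℕ} (κ : Kernel ℝ≥0 (Fin m → ℝ≥0)) [IsMarkovKernel κ]
    (hκ : ∀ y, κ y = jointLaw K m y) (y : ℝ≥0) :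
    jointLaw K (m + 1) y = (consKernel κ ∘ₖ K) y := by
  rw [Kernel.comp_apply, jointLaw]
  congr 1
  funext x
  rw [consKernel_apply, hκ]

theorem exists_kernel_eq_jointLaw [IsMarkovKernel K] (m : ℕ) :
    ∃ κ : Kernel ℝ≥0 (Fin m → ℝ≥0), IsMarkovKernel κ ∧ ∀ y, κ y = jointLaw K m y := by
  induction m with
  | zero =>
    exact ⟨Kernel.const _ (Measure.dirac fun i => i.elim0), inferInstance, fun y => by
      rw [Kernel.const_apply, jointLaw]⟩
  | succ m ih =>
    obtain ⟨κ, hκ, h⟩ := ih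
    exact ⟨consKernel κ ∘ₖ K, inferInstance, fun y => (jointLaw_succ_eq_comp K κ h y).symm⟩

instance isProbabilityMeasure_jointLaw [IsMarkovKernel K] (m : ℕ) (y : ℝ≥0) :
    IsProbabilityMeasure (jointLaw K m y) := by
  obtain ⟨κ, hκ, h⟩ := exists_kernel_eq_jointLaw K m
  rw [← h]
  infer_instance

theorem integral_jointLaw_succ [IsMarkovKernel K] {m : ℕ} (y : ℝ≥0)
    {f : (Fin (m + 1) → ℝ≥0) → ℝ} (hf : Measurable f) {M : ℝ} (hM : ∀ x, |f x| ≤ M) :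
    ∫ x, f x ∂(jointLaw K (m + 1) y) =
      ∫ a, ∫ x, f (Fin.cons a x) ∂(jointLaw K m a) ∂(K y) := by
  obtain ⟨κ, hκ, h⟩ := exists_kernel_eq_jointLaw K m
  rw [jointLaw_succ_eq_comp K κ h, Kernel.integral_comp
    (Integrable.of_bound hf.aestronglyMeasurable M (ae_of_all _ hM))]
  refine integral_congr_ae (ae_of_all _ fun a => ?_)
  simp only
  rw [consKernel_apply, h, integral_map (measurable_finCons m a).aemeasurable
    hf.aestronglyMeasurable]

theorem stronglyMeasurable_integral_jointLaw [IsMarkovKernel K] {m : ℕ}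
    {f : ℝ≥0 → (Fin m → ℝ≥0) → ℝ} (hf : Measurable (Function.uncurry f)) :
    StronglyMeasurable fun a => ∫ x, f a x ∂(jointLaw K m a) := by
  obtain ⟨κ, hκ, h⟩ := exists_kernel_eq_jointLaw K m
  simp_rw [← h]
  exact hf.stronglyMeasurable.integral_kernel_prod_right (κ := κ)

end JointLaw

section TailChain

variable (G : Measure ℝ≥0) [IsProbabilityMeasure G]

theorem continuous_tailChain (m : ℕ) : Continuous fun p : ℝ≥0 × (Fin m → ℝ≥0) =>
    fun i : Fin m => p.1 * ∏ j ∈ Finset.Iic i, p.2 j := by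
  fun_prop

theorem measurable_tailChain (m : ℕ) (u : ℝ≥0) : Measurable fun (ξ : Fin m → ℝ≥0) (i : Fin m) =>
    u * ∏ j ∈ Finset.Iic i, ξ j :=
  ((continuous_tailChain m).comp (Continuous.prodMk_right u)).measurable

instance isProbabilityMeasure_tailChainLaw (m : ℕ) (u : ℝ≥0) :
    IsProbabilityMeasure (tailChainLaw G m u) :=
  Measure.isProbabilityMeasure_map (measurable_tailChain m u).aemeasurable

theorem integral_tailChainLaw (m : ℕ) (u : ℝ≥0) {f : (Fin m → ℝ≥0) → ℝ} (hf : Measurable f) :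
    ∫ x, f x ∂(tailChainLaw G m u) =
      ∫ ξ, f (fun i => u * ∏ j ∈ Finset.Iic i, ξ j) ∂(Measure.pi fun _ : Fin m => G) :=
  integral_map (measurable_tailChain m u).aemeasurable hf.aestronglyMeasurable

theorem tailChain_cons {m : ℕ} (u a : ℝ≥0) (ξ : Fin m → ℝ≥0) :
    (fun i : Fin (m + 1) => u * ∏ j ∈ Finset.Iic i, (Fin.cons a ξ : Fin (m + 1) → ℝ≥0) j) =
      Fin.cons (u * a) fun i => u * a * ∏ j ∈ Finset.Iic i, ξ j := by
  funext i
  refine Fin.cases ?_ (fun k => ?_) i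
  · have : Finset.Iic (0 : Fin (m + 1)) = {0} := by ext j; simp
    simp [this]
  · have : Finset.Iic k.succ = Finset.cons 0 ((Finset.Iic k).map (Fin.succEmb m))
        (by simp) := by
      ext j
      refine Fin.cases ?_ (fun l => ?_) j <;> simp
    rw [this, Finset.prod_cons, Finset.prod_map]
    simp [mul_assoc]

theorem integral_tailChainLaw_succ {m : ℕ} (u : ℝ≥0)
    {f : (Fin (m + 1) → ℝ≥0) → ℝ} (hf : Measurable f) {M : ℝ} (hM : ∀ x, |f x| ≤ M) :
    ∫ x, f x ∂(tailChainLaw G (m + 1) u) =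
      ∫ a, ∫ x, f (Fin.cons (u * a) x) ∂(tailChainLaw G m (u * a)) ∂G := by
  have hint : Integrable (fun p : ℝ≥0 × (Fin m → ℝ≥0) =>
      f (fun i => u * ∏ j ∈ Finset.Iic i, (Fin.cons p.1 p.2 : Fin (m + 1) → ℝ≥0) j))
      (G.prod (Measure.pi fun _ : Fin m => G)) :=
    Integrable.of_bound (hf.comp ((measurable_tailChain _ u).comp
      (measurable_finCons_uncurry m))).aestronglyMeasurable M (ae_of_all _ fun _ => hM _)
  have key := (measurePreserving_piFinSuccAbove (fun _ : Fin (m + 1) => G) 0).symm.integral_comp'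
    (g := fun ξ => f (fun i => u * ∏ j ∈ Finset.Iic i, ξ j))
  rw [integral_tailChainLaw G _ u hf, ← key]
  have e : ∀ p : ℝ≥0 × (Fin m → ℝ≥0),
      (MeasurableEquiv.piFinSuccAbove (fun _ : Fin (m + 1) => ℝ≥0) 0).symm p =
        (Fin.cons p.1 p.2 : Fin (m + 1) → ℝ≥0) := fun p => by
    simp [MeasurableEquiv.piFinSuccAbove_symm_apply, Fin.insertNthEquiv]
  simp_rw [e]
  rw [integral_prod _ hint]
  refine integral_congr_ae (ae_of_all _ fun a => ?_)
  simp only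
  simp_rw [tailChain_cons]
  exact (integral_tailChainLaw G m _ (hf.comp (measurable_finCons m _))).symm

end TailChain

theorem tendsto_prod_of_forall_tendsto {F : ℝ≥0 → ℝ≥0 → ℝ} {a : ℝ≥0} {L : ℝ}
    (h : ∀ u : ℝ≥0 → ℝ≥0, Tendsto u atTop (𝓝 a) → Tendsto (fun t => F t (u t)) atTop (𝓝 L)) :
    Tendsto (fun p : ℝ≥0 × ℝ≥0 => F p.1 p.2) (atTop ×ˢ 𝓝 a) (𝓝 L) := by
  classical
  intro s hs
  by_contra hcon
  have hfreq : ∃ᶠ p : ℝ≥0 × ℝ≥0 in atTop ×ˢ 𝓝 a, F p.1 p.2 ∉ s := fun h =>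
    hcon (h.mono fun p hp => not_not.1 hp)
  obtain ⟨p, hp, hps⟩ := exists_seq_forall_of_frequently hfreq
  have hp1 : Tendsto (fun n => (p n).1) atTop atTop := tendsto_fst.comp hp
  have hp2 : Tendsto (fun n => (p n).2) atTop (𝓝 a) := tendsto_snd.comp hp
  let u : ℝ≥0 → ℝ≥0 := fun t => if h : ∃ n, (p n).1 = t then (p h.choose).2 else a
  have hu : Tendsto u atTop (𝓝 a) := by
    refine tendsto_def.2 fun V hV => ?_
    obtain ⟨N, hN⟩ := eventually_atTop.1 (hp2.eventually hV)
    filter_upwards [eventually_gt_atTop ((Finset.range N).sup fun n => (p n).1)] with t ht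
    simp only [Set.mem_preimage, u]
    split_ifs with hex
    · refine hN _ (not_lt.1 fun hlt => ?_)
      have := Finset.le_sup (f := fun n => (p n).1) (Finset.mem_range.2 hlt)
      simp only [hex.choose_spec] at this
      exact absurd ht (not_lt.2 this)
    · exact mem_of_mem_nhds hV
  obtain ⟨n, hn⟩ := (hp1.eventually ((h u hu).eventually hs)).exists
  have hex : ∃ k, (p k).1 = (p n).1 := ⟨n, rfl⟩
  have hk := hps hex.choose
  simp only [u, dif_pos hex] at hn
  rw [hex.choose_spec] at hk
  exact hk hn

theorem tendsto_fst_mul_snd_atTop {u : ℝ≥0} (hu : 0 < u) :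
    Tendsto (fun p : ℝ≥0 × ℝ≥0 => p.1 * p.2) (atTop ×ˢ 𝓝 u) atTop := by
  refine tendsto_atTop.2 fun b => ?_
  have h2 : 0 < u / 2 := half_pos hu
  filter_upwards [tendsto_fst.eventually (eventually_ge_atTop (b / (u / 2))),
    tendsto_snd.eventually (lt_mem_nhds (half_lt_self hu))] with p hp1 hp2
  exact ((div_le_iff₀ h2).1 hp1).trans (mul_le_mul_right hp2.le _)

theorem tendsto_div_atTop_zero (x : ℝ≥0) : Tendsto (fun t : ℝ≥0 => x / t) atTop (𝓝 0) := by
  rw [← NNReal.tendsto_coe]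
  simp only [NNReal.coe_div]
  exact tendsto_const_nhds.div_atTop (NNReal.tendsto_coe_atTop.2 tendsto_id)

section DomainOfAttraction

variable {K : Kernel ℝ≥0 ℝ≥0} {G : Measure ℝ≥0}

theorem KernelDOA.tendsto_integral (hK : KernelDOA K G) {g : ℝ≥0 → ℝ} (hg : Continuous g)
    (hs : HasCompactSupport g) :
    Tendsto (fun t : ℝ≥0 => ∫ x, g (x / t) ∂(K t)) atTop (𝓝 (∫ x, g x ∂G)) := by
  obtain ⟨f, hf⟩ := exists_continuousMap_eq_of_hasCompactSupport g hg hs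
  simpa only [hf] using hK f

variable [IsMarkovKernel K] [IsProbabilityMeasure G]

theorem KernelDOA.tendsto_integral_scaled (hK : KernelDOA K G) {l : Filter (ℝ≥0 × ℝ≥0)}
    {u : ℝ≥0} (hsnd : Tendsto Prod.snd l (𝓝 u)) (hmul : Tendsto (fun p => p.1 * p.2) l atTop)
    {g : ℝ≥0 → ℝ} (hg : Continuous g) (hs : HasCompactSupport g) :
    Tendsto (fun p => ∫ x, g (x / p.1) ∂(K (p.1 * p.2))) l (𝓝 (∫ x, g (u * x) ∂G)) := by
  obtain ⟨M, hM⟩ := hs.exists_bound_of_continuous hg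
  refine tendsto_integral_of_continuous_convergence (fun p : ℝ≥0 × ℝ≥0 => K (p.1 * p.2))
    (fun p x => x / (p.1 * p.2)) (fun p => measurable_id.div_const _) G
    (fun g hg hs => (hK.tendsto_integral hg hs).comp hmul)
    (fun p x => g (x / p.1))
    (fun p => (hg.measurable.comp (measurable_id.div_const _)).aestronglyMeasurable)
    (fun x => g (u * x)) (by fun_prop) M (fun _ _ => hM _) (fun _ => hM _) fun η hη => ?_
  refine ⟨fun _ => ∅, by simpa using tendsto_const_nhds, fun w₀ => ?_⟩
  have h1 : Tendsto (fun q : (ℝ≥0 × ℝ≥0) × ℝ≥0 => g (q.1.2 * q.2)) (l ×ˢ 𝓝 w₀)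
      (𝓝 (g (u * w₀))) :=
    (hg.tendsto _).comp ((hsnd.comp tendsto_fst).mul tendsto_snd)
  filter_upwards [Metric.tendsto_nhds.1 h1 η hη,
    (hmul.comp tendsto_fst).eventually (eventually_gt_atTop 0)] with q hq hpos x hx _
  have hne : q.1.1 * q.1.2 ≠ 0 := ne_of_gt hpos
  have h2 : x / q.1.1 = q.1.2 * q.2 := by
    rw [← hx]
    have := left_ne_zero_of_mul hne
    have := right_ne_zero_of_mul hne
    field_simp
  rw [h2]
  exact (Real.dist_eq _ _ ▸ hq).le

theorem KernelDOA.tendsto_measure_Iic_diff_zero (hK : KernelDOA K G)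
    (h0 : Tendsto (fun t : ℝ≥0 => K t {0}) atTop (𝓝 (G {0}))) (C : ℝ≥0) :
    Tendsto (fun y => K y (Set.Iic C \ {0})) atTop (𝓝 0) := by
  let φ : ℕ → ℝ≥0 → ℝ := fun n x => max 0 (min 1 (2 - n * x))
  have hφc : ∀ n, Continuous (φ n) := fun n => by fun_prop
  have hφ0 : ∀ n x, 0 ≤ φ n x := fun n x => le_max_left _ _
  have hφ1 : ∀ n x, φ n x ≤ 1 := fun n x => max_le zero_le_one (min_le_left _ _)
  have hφn : ∀ n x, ‖φ n x‖ ≤ 1 := fun n x => by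
    rw [Real.norm_eq_abs, abs_of_nonneg (hφ0 n x)]; exact hφ1 n x
  have hφs : ∀ n : ℕ, 1 ≤ n → HasCompactSupport (φ n) := fun n hn =>
    HasCompactSupport.intro (isCompact_Icc (a := (0 : ℝ≥0)) (b := 2)) fun x hx => by
      have h1 : (2 : ℝ≥0) < x := by simpa using hx
      have h2 : (2 : ℝ) < x := by exact_mod_cast h1
      have h3 : (1 : ℝ) ≤ n := by exact_mod_cast hn
      exact max_eq_left ((min_le_right _ _).trans (by nlinarith))
  have hlim : Tendsto (fun n => ∫ x, φ n x ∂G) atTop (𝓝 (G.real {0})) := by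
    rw [← integral_indicator_one (measurableSet_singleton _)]
    refine tendsto_integral_of_dominated_convergence (fun _ => 1)
      (fun n => (hφc n).aestronglyMeasurable) (integrable_const _)
      (fun n => ae_of_all _ (hφn n)) (ae_of_all _ fun x => ?_)
    rcases eq_or_ne x 0 with rfl | hx
    · simp [φ]
    · rw [Set.indicator_of_notMem (by simpa using hx)]
      obtain ⟨N, hN⟩ := exists_nat_ge (2 / (x : ℝ))
      have hx' : (0 : ℝ) < x := by exact_mod_cast hx.bot_lt
      refine tendsto_const_nhds.congr' ?_
      filter_upwards [eventually_ge_atTop N] with n hn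
      have h1 : (N : ℝ) ≤ n := by exact_mod_cast hn
      have h2 : 2 ≤ (n : ℝ) * x := (div_le_iff₀ hx').1 (hN.trans h1)
      exact (max_eq_left ((min_le_right _ _).trans (by linarith))).symm
  have h0' : Tendsto (fun t : ℝ≥0 => (K t).real {0}) atTop (𝓝 (G.real {0})) :=
    (ENNReal.tendsto_toReal (measure_ne_top _ _)).comp h0
  suffices Tendsto (fun y => (K y).real (Set.Iic C \ {0})) atTop (𝓝 0) by
    rw [← ENNReal.tendsto_toReal_iff (fun _ => measure_ne_top _ _) ENNReal.zero_ne_top]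
    exact this
  rw [Metric.tendsto_nhds]
  intro ε hε
  obtain ⟨n, hn, hn1⟩ := ((hlim.eventually (gt_mem_nhds (show G.real {0} < G.real {0} + ε / 2 by
    linarith))).and (eventually_ge_atTop 1)).exists
  filter_upwards [(hK.tendsto_integral (hφc n) (hφs n hn1)).eventually (gt_mem_nhds hn),
    h0'.eventually (lt_mem_nhds (show G.real {0} - ε / 2 < G.real {0} by linarith)),
    eventually_gt_atTop 0, eventually_ge_atTop (n * C)] with y h1 h2 h3 h4
  have hle : (K y).real (Set.Iic C) ≤ ∫ x, φ n (x / y) ∂(K y) := by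
    rw [← integral_indicator_one measurableSet_Iic]
    refine integral_mono ((integrable_const _).indicator measurableSet_Iic)
      (Integrable.of_bound ((hφc n).measurable.comp
        (measurable_id.div_const _)).aestronglyMeasurable 1 (ae_of_all _ fun x => hφn n _))
      fun x => ?_
    by_cases hx : x ∈ Set.Iic C
    · rw [Set.indicator_of_mem hx]
      have h5 : (n : ℝ≥0) * (x / y) ≤ 1 := by
        rw [← mul_div_assoc, div_le_one h3]
        exact (mul_le_mul_right hx _).trans h4
      have h6 : (n : ℝ) * ((x / y : ℝ≥0) : ℝ) ≤ 1 := by exact_mod_cast h5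
      simp only [φ, Pi.one_apply]
      rw [min_eq_left (by linarith)]
      exact le_max_right _ _
    · rw [Set.indicator_of_notMem hx]
      exact hφ0 _ _
  have hdiff : (K y).real (Set.Iic C \ {0}) = (K y).real (Set.Iic C) - (K y).real {0} :=
    measureReal_sdiff (by simp) (measurableSet_singleton _)
  rw [Real.dist_eq, sub_zero, abs_of_nonneg measureReal_nonneg, hdiff]
  linarith

end DomainOfAttraction

section WeakConvergence

/-- The pairs `(t, v)` with `t → ∞` and `v → u` along which the state `t * v` tends to `l`. -/
def stateFilter (l : Filter ℝ≥0) (u : ℝ≥0) : Filter (ℝ≥0 × ℝ≥0) :=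
  (atTop ×ˢ 𝓝 u) ⊓ comap (fun p => p.1 * p.2) l

theorem stateFilter_eq_of_pos {l : Filter ℝ≥0} (hl : atTop ≤ l) {u : ℝ≥0} (hu : 0 < u) :
    stateFilter l u = atTop ×ˢ 𝓝 u :=
  inf_eq_left.2 (tendsto_iff_comap.1 ((tendsto_fst_mul_snd_atTop hu).mono_right hl))

theorem measurable_coe_div (m : ℕ) (t : ℝ≥0) : Measurable fun (x : Fin m → ℝ≥0) (i : Fin m) =>
    ((x i / t : ℝ≥0) : ℝ≥0∞) := by
  refine measurable_pi_iff.2 fun i => ?_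
  have h : Measurable fun x : Fin m → ℝ≥0 => x i := measurable_pi_apply i
  exact (h.div_const t).coe_nnreal_ennreal

variable (K : Kernel ℝ≥0 ℝ≥0) [IsMarkovKernel K] (G : Measure ℝ≥0) [IsProbabilityMeasure G]

theorem tendsto_integral_jointLaw_const {m : ℕ} (f : C(Fin m → ℝ≥0∞, ℝ)) (y : ℝ≥0) :
    Tendsto (fun t : ℝ≥0 => ∫ x, f (fun i => ((x i / t : ℝ≥0) : ℝ≥0∞)) ∂(jointLaw K m y)) atTop
      (𝓝 (f 0)) := by
  have : f 0 = ∫ _, f 0 ∂(jointLaw K m y) := by simp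
  rw [this]
  refine tendsto_integral_filter_of_dominated_convergence (fun _ => ‖f‖)
    (Eventually.of_forall fun t => ?_) (Eventually.of_forall fun t => ae_of_all _ fun x =>
      f.norm_coe_le_norm _) (integrable_const _) (ae_of_all _ fun x => ?_)
  · exact (f.continuous.measurable.comp (measurable_coe_div m t)).aestronglyMeasurable
  · refine (f.continuous.tendsto 0).comp (tendsto_pi_nhds.2 fun i => ?_)
    exact ENNReal.tendsto_coe.2 (tendsto_div_atTop_zero (x i))

theorem continuous_integral_tailChainLaw {m : ℕ} (F : C(ℝ≥0∞, C(Fin m → ℝ≥0∞, ℝ))) {M : ℝ}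
    (hM : ∀ w z, |F w z| ≤ M) :
    Continuous fun w : ℝ≥0 => ∫ x, F w (fun i => (x i : ℝ≥0∞)) ∂(tailChainLaw G m w) := by
  have hmeas : ∀ w : ℝ≥0, Continuous fun x : Fin m → ℝ≥0 => F w (fun i => (x i : ℝ≥0∞)) :=
    fun w => (F w).continuous.comp (continuous_pi fun i =>
      ENNReal.continuous_coe.comp (continuous_apply i))
  simp_rw [fun w => integral_tailChainLaw G m w (hmeas w).measurable]
  have hjoint : Continuous fun p : ℝ≥0 × (Fin m → ℝ≥0) =>
      F p.1 (fun i => ((p.1 * ∏ j ∈ Finset.Iic i, p.2 j : ℝ≥0) : ℝ≥0∞)) := by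
    refine (ContinuousMap.continuous_uncurry_of_continuous F).comp
      ((ENNReal.continuous_coe.comp continuous_fst).prodMk (continuous_pi fun i => ?_))
    exact ENNReal.continuous_coe.comp ((continuous_apply i).comp (continuous_tailChain m))
  refine continuous_of_dominated (bound := fun _ => M) (fun w => ?_)
    (fun w => ae_of_all _ fun ξ => hM _ _) (integrable_const _) (ae_of_all _ fun ξ => ?_)
  · exact (hjoint.comp (Continuous.prodMk_right w)).aestronglyMeasurable
  · exact hjoint.comp (Continuous.prodMk_left ξ)

theorem tendsto_integral_jointLaw {l : Filter ℝ≥0} (hl : atTop ≤ l)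
    (hdiff : ∀ S ∈ l, Tendsto (fun y => K y (Sᶜ \ {0})) l (𝓝 0))
    (hstep : ∀ (u : ℝ≥0) (g : ℝ≥0 → ℝ), Continuous g → HasCompactSupport g →
      Tendsto (fun p : ℝ≥0 × ℝ≥0 => ∫ x, g (x / p.1) ∂(K (p.1 * p.2))) (stateFilter l u)
        (𝓝 (∫ x, g (u * x) ∂G))) (m : ℕ) :
    ∀ (u : ℝ≥0) (f : C(Fin m → ℝ≥0∞, ℝ)),
      Tendsto (fun p : ℝ≥0 × ℝ≥0 =>
          ∫ x, f (fun i => ((x i / p.1 : ℝ≥0) : ℝ≥0∞)) ∂(jointLaw K m (p.1 * p.2)))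
        (stateFilter l u) (𝓝 (∫ x, f (fun i => (x i : ℝ≥0∞)) ∂(tailChainLaw G m u))) := by
  induction m with
  | zero =>
    intro u f
    have h1 : ∀ x : Fin 0 → ℝ≥0∞, f x = f 0 := fun x => by rw [Subsingleton.elim x 0]
    simp only [h1, integral_const, probReal_univ, smul_eq_mul, one_mul]
    exact tendsto_const_nhds
  | succ m ih =>
    intro u f
    let F : C(ℝ≥0∞, C(Fin m → ℝ≥0∞, ℝ)) := (f.comp ⟨fun p : ℝ≥0∞ × (Fin m → ℝ≥0∞) =>
      (Fin.cons p.1 p.2 : Fin (m + 1) → ℝ≥0∞), by fun_prop⟩).curry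
    have hF : ∀ w z, F w z = f (Fin.cons w z) := fun _ _ => rfl
    have hFM : ∀ w z, |F w z| ≤ ‖f‖ := fun w z => f.norm_coe_le_norm _
    let H : ℝ≥0 → ℝ≥0 → ℝ := fun t a =>
      ∫ x, F ((a / t : ℝ≥0) : ℝ≥0∞) (fun i => ((x i / t : ℝ≥0) : ℝ≥0∞)) ∂(jointLaw K m a)
    let H₀ : ℝ≥0 → ℝ := fun w => ∫ x, F w (fun i => (x i : ℝ≥0∞)) ∂(tailChainLaw G m w)
    have hbound : ∀ {Ω : Type} [MeasurableSpace Ω] (ν : Measure Ω) [IsProbabilityMeasure ν]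
        (φ : Ω → ℝ), (∀ x, |φ x| ≤ ‖f‖) → |∫ x, φ x ∂ν| ≤ ‖f‖ := fun ν _ φ h => by
      simpa using norm_integral_le_of_norm_le_const (μ := ν) (f := φ) (ae_of_all _ h)
    have hcoe : ∀ k : ℕ, Measurable fun (x : Fin k → ℝ≥0) (i : Fin k) => (x i : ℝ≥0∞) :=
      fun k => measurable_pi_iff.2 fun i => (measurable_pi_apply i).coe_nnreal_ennreal
    have hcons : ∀ (t a : ℝ≥0) (x : Fin m → ℝ≥0),
        f (fun i => (((Fin.cons a x : Fin (m + 1) → ℝ≥0) i / t : ℝ≥0) : ℝ≥0∞)) =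
          F ((a / t : ℝ≥0) : ℝ≥0∞) (fun i => ((x i / t : ℝ≥0) : ℝ≥0∞)) := fun t a x => by
      rw [hF]
      congr 1
      funext i
      refine Fin.cases ?_ (fun j => ?_) i <;> simp
    have hcons' : ∀ (a : ℝ≥0) (x : Fin m → ℝ≥0),
        f (fun i => ((Fin.cons a x : Fin (m + 1) → ℝ≥0) i : ℝ≥0∞)) =
          F a (fun i => (x i : ℝ≥0∞)) := fun a x => by
      rw [hF]
      congr 1
      funext i
      refine Fin.cases ?_ (fun j => ?_) i <;> simp
    have hleft : ∀ p : ℝ≥0 × ℝ≥0,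
        ∫ x, f (fun i => ((x i / p.1 : ℝ≥0) : ℝ≥0∞)) ∂(jointLaw K (m + 1) (p.1 * p.2)) =
          ∫ a, H p.1 a ∂(K (p.1 * p.2)) := fun p => by
      rw [integral_jointLaw_succ K _ (f := fun x => f (fun i => ((x i / p.1 : ℝ≥0) : ℝ≥0∞)))
        (f.continuous.measurable.comp (measurable_coe_div _ p.1)) fun x => f.norm_coe_le_norm _]
      simp only [hcons, H]
    have hright : ∫ x, f (fun i => (x i : ℝ≥0∞)) ∂(tailChainLaw G (m + 1) u) =
        ∫ w, H₀ w ∂(G.map (u * ·)) := by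
      rw [integral_map (measurable_const_mul u).aemeasurable
        (continuous_integral_tailChainLaw G F hFM).aestronglyMeasurable,
        integral_tailChainLaw_succ G u (f := fun x => f (fun i => (x i : ℝ≥0∞)))
        (f.continuous.measurable.comp (hcoe _)) fun x => f.norm_coe_le_norm _]
      simp only [hcons']
    have hHm : ∀ t, StronglyMeasurable (H t) := fun t => by
      refine stronglyMeasurable_integral_jointLaw K
        (f := fun a x => F ((a / t : ℝ≥0) : ℝ≥0∞) (fun i => ((x i / t : ℝ≥0) : ℝ≥0∞))) ?_
      have h : Measurable fun q : ℝ≥0 × (Fin m → ℝ≥0) =>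
          f (fun i => (((Fin.cons q.1 q.2 : Fin (m + 1) → ℝ≥0) i / t : ℝ≥0) : ℝ≥0∞)) :=
        f.continuous.measurable.comp
          ((measurable_coe_div (m + 1) t).comp (measurable_finCons_uncurry m))
      simp_rw [hcons] at h
      exact h
    have hzero : H₀ 0 = F 0 0 := by
      have : ∀ ξ : Fin m → ℝ≥0, (fun i => ((0 * ∏ j ∈ Finset.Iic i, ξ j : ℝ≥0) : ℝ≥0∞)) = 0 :=
        fun ξ => by funext i; simp
      simp only [H₀]
      rw [integral_tailChainLaw G m 0 (f := fun x => F ((0 : ℝ≥0) : ℝ≥0∞) (fun i => (x i : ℝ≥0∞)))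
        ((F _).continuous.measurable.comp (hcoe _))]
      simp only [this, integral_const, probReal_univ, one_smul, ENNReal.coe_zero]
    have hclose : ∀ w₀ : ℝ≥0, ∀ η : ℝ, 0 < η → ∀ᶠ w : ℝ≥0 in 𝓝 w₀, ∀ (t y : ℝ≥0),
        |∫ x, F w (fun i => ((x i / t : ℝ≥0) : ℝ≥0∞)) ∂(jointLaw K m y) -
          ∫ x, F w₀ (fun i => ((x i / t : ℝ≥0) : ℝ≥0∞)) ∂(jointLaw K m y)| ≤ η := by
      intro w₀ η hη
      have hc : Tendsto (fun w : ℝ≥0 => F w) (𝓝 w₀) (𝓝 (F w₀)) :=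
        (F.continuous.comp ENNReal.continuous_coe).tendsto w₀
      filter_upwards [Metric.tendsto_nhds.1 hc η hη] with w hw t y
      have hi : ∀ w : ℝ≥0, Integrable (fun x : Fin m → ℝ≥0 =>
          F w (fun i => ((x i / t : ℝ≥0) : ℝ≥0∞))) (jointLaw K m y) := fun w =>
        Integrable.of_bound ((F w).continuous.measurable.comp
          (measurable_coe_div m t)).aestronglyMeasurable ‖f‖ (ae_of_all _ fun x => hFM _ _)
      rw [← integral_sub (hi w) (hi w₀)]
      have := norm_integral_le_of_norm_le_const (μ := jointLaw K m y) (C := η)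
        (f := fun x => F w (fun i => ((x i / t : ℝ≥0) : ℝ≥0∞)) -
          F w₀ (fun i => ((x i / t : ℝ≥0) : ℝ≥0∞)))
        (ae_of_all _ fun x => by
          rw [← dist_eq_norm]
          exact (ContinuousMap.dist_apply_le_dist _).trans hw.le)
      simpa using this
    have hstate : ∀ w₀ : ℝ≥0, ∀ η : ℝ, 0 < η → ∀ᶠ p in stateFilter l w₀,
        |∫ x, F p.2 (fun i => ((x i / p.1 : ℝ≥0) : ℝ≥0∞)) ∂(jointLaw K m (p.1 * p.2)) -
          H₀ w₀| ≤ η := by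
      intro w₀ η hη
      have hle : stateFilter l w₀ ≤ atTop ×ˢ 𝓝 w₀ := inf_le_left
      filter_upwards [Metric.tendsto_nhds.1 (ih w₀ (F w₀)) (η / 2) (by positivity),
        hle (tendsto_snd.eventually (hclose w₀ (η / 2) (by positivity)))] with p hp1 hp2
      rw [Real.dist_eq] at hp1
      exact (abs_sub_le _ (∫ x, F w₀ (fun i => ((x i / p.1 : ℝ≥0) : ℝ≥0∞))
        ∂(jointLaw K m (p.1 * p.2))) _).trans (by linarith [hp2 p.1 (p.1 * p.2)])
    have : IsProbabilityMeasure (G.map (u * ·)) :=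
      Measure.isProbabilityMeasure_map (measurable_const_mul u).aemeasurable
    simp_rw [hleft]
    rw [hright]
    refine tendsto_integral_of_continuous_convergence (fun p : ℝ≥0 × ℝ≥0 => K (p.1 * p.2))
      (fun p x => x / p.1) (fun p => measurable_id.div_const _) _ (fun g hg hs => ?_)
      (fun p => H p.1) (fun p => (hHm p.1).aestronglyMeasurable) H₀
      (continuous_integral_tailChainLaw G F hFM) ‖f‖
      (fun p a => hbound _ _ fun x => hFM _ _) (fun w => hbound _ _ fun x => hFM _ _)
      fun η hη => ?_
    · rw [integral_map (measurable_const_mul u).aemeasurable hg.aestronglyMeasurable]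
      exact hstep u g hg hs
    obtain ⟨S, hS, hS0⟩ : ∃ S ∈ l, ∀ᶠ p : ℝ≥0 × ℝ≥0 in atTop ×ˢ 𝓝 0, p.1 * p.2 ∈ S →
        |∫ x, F p.2 (fun i => ((x i / p.1 : ℝ≥0) : ℝ≥0∞)) ∂(jointLaw K m (p.1 * p.2)) -
          H₀ 0| ≤ η := by
      obtain ⟨s, hs, t, ⟨S, hS, hSt⟩, hst⟩ := Filter.mem_inf_iff_superset.1 (hstate 0 η hη)
      refine ⟨S, hS, ?_⟩
      filter_upwards [hs] with p hp hpS
      exact hst ⟨hp, hSt hpS⟩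
    refine ⟨fun _ => Sᶜ \ {0}, (hdiff S hS).comp (tendsto_comap.mono_left inf_le_right),
      fun w₀ => ?_⟩
    have hfst : Tendsto (fun q : (ℝ≥0 × ℝ≥0) × ℝ≥0 => q.1.1) (stateFilter l u ×ˢ 𝓝 w₀) atTop :=
      (tendsto_fst.mono_left inf_le_left).comp tendsto_fst
    have hpair : Tendsto (fun q : (ℝ≥0 × ℝ≥0) × ℝ≥0 => (q.1.1, q.2)) (stateFilter l u ×ˢ 𝓝 w₀)
        (atTop ×ˢ 𝓝 w₀) := hfst.prodMk tendsto_snd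
    have hH : ∀ {t a w : ℝ≥0}, 0 < t → a / t = w →
        a = t * w ∧ H t a = ∫ x, F w (fun i => ((x i / t : ℝ≥0) : ℝ≥0∞))
          ∂(jointLaw K m (t * w)) := fun {t a w} ht h => by
      have h1 : a = t * w := by rw [← h, mul_div_cancel₀ _ ht.ne']
      refine ⟨h1, ?_⟩
      simp only [H, h, ← h1]
    rcases eq_zero_or_pos w₀ with rfl | hw₀
    · have hfix := tendsto_integral_jointLaw_const K (F 0) 0
      rw [← hzero] at hfix
      filter_upwards [hpair.eventually hS0, hfst.eventually (eventually_gt_atTop 0),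
        hfst.eventually (Metric.tendsto_nhds.1 hfix η hη)] with q hq ht hq0 a ha haB
      obtain ⟨h1, h2⟩ := hH ht ha
      rw [h2]
      by_cases haS : a ∈ S
      · exact hq (h1 ▸ haS)
      · have ha0 : a = 0 := by
          by_contra h0
          exact haB ⟨haS, h0⟩
        have hw : q.2 = 0 := by rw [← ha, ha0, zero_div]
        rw [hw, mul_zero]
        exact (Real.dist_eq _ _ ▸ hq0).le
    · have := hstate w₀ η hη
      rw [stateFilter_eq_of_pos hl hw₀] at this
      filter_upwards [hpair.eventually this, hfst.eventually (eventually_gt_atTop 0)]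
        with q hq ht a ha _
      rw [(hH ht ha).2]
      exact hq

end WeakConvergence

section ExtremalComponent

variable {K : Kernel ℝ≥0 ℝ≥0} [IsMarkovKernel K] {G : Measure ℝ≥0} [IsProbabilityMeasure G]

theorem tendsto_integral_jointLaw_of_extremalBoundary_zero (hK : KernelDOA K G)
    (h0 : ExtremalBoundary K G fun _ => 0) {m : ℕ} {u : ℝ≥0} (hu : 0 < u)
    (f : C(Fin m → ℝ≥0∞, ℝ)) :
    Tendsto (fun p : ℝ≥0 × ℝ≥0 =>
        ∫ x, f (fun i => ((x i / p.1 : ℝ≥0) : ℝ≥0∞)) ∂(jointLaw K m (p.1 * p.2)))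
      (atTop ×ˢ 𝓝 u) (𝓝 (∫ x, f (fun i => (x i : ℝ≥0∞)) ∂(tailChainLaw G m u))) := by
  have hIic : Set.Iic (0 : ℝ≥0) = {0} := by ext; simp
  have h0' : Tendsto (fun t : ℝ≥0 => K t {0}) atTop (𝓝 (G {0})) := by
    simpa only [mul_zero, hIic] using h0.2
  rw [← stateFilter_eq_of_pos le_rfl hu]
  refine tendsto_integral_jointLaw K G le_rfl (fun S hS => ?_) (fun u g hg hs =>
    hK.tendsto_integral_scaled (tendsto_snd.mono_left inf_le_left)
      (tendsto_comap.mono_left inf_le_right) hg hs) m u f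
  obtain ⟨C, hC⟩ := mem_atTop_sets.1 hS
  refine tendsto_of_tendsto_of_tendsto_of_le_of_le tendsto_const_nhds
    (hK.tendsto_measure_Iic_diff_zero h0' C) (fun _ => zero_le) fun y =>
      measure_mono (Set.sdiff_subset_sdiff_left fun x hx => ?_)
  by_contra h
  exact hx (hC x (not_le.1 h).le)

theorem tendsto_integral_jointLaw_of_regCond (hK : KernelDOA K G) (hreg : RegCond K) {m : ℕ}
    {u : ℝ≥0} (hu : 0 < u) (f : C(Fin m → ℝ≥0∞, ℝ)) :
    Tendsto (fun p : ℝ≥0 × ℝ≥0 =>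
        ∫ x, f (fun i => ((x i / p.1 : ℝ≥0) : ℝ≥0∞)) ∂(jointLaw K m (p.1 * p.2)))
      (atTop ×ˢ 𝓝 u) (𝓝 (∫ x, f (fun i => (x i : ℝ≥0∞)) ∂(tailChainLaw G m u))) := by
  rw [← stateFilter_eq_of_pos le_top hu]
  refine tendsto_integral_jointLaw K G le_top (fun S hS => ?_) (fun v g hg hs => ?_) m u f
  · simp [mem_top.1 hS]
  rcases eq_zero_or_pos v with rfl | hv
  · obtain ⟨f, hf⟩ := exists_continuousMap_eq_of_hasCompactSupport g hg hs
    have h := tendsto_prod_of_forall_tendsto (a := 0) (L := f 0)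
      (F := fun t v => ∫ x, f ((x / t : ℝ≥0) : ℝ≥0∞) ∂(K (t * v))) fun w hw => hreg w hw f
    have h00 : f 0 = g 0 := by simpa using hf 0
    simp only [hf, h00] at h
    have hle : stateFilter ⊤ 0 ≤ atTop ×ˢ 𝓝 0 := inf_le_left
    simpa using h.mono_left hle
  · rw [stateFilter_eq_of_pos le_top hv]
    exact hK.tendsto_integral_scaled tendsto_snd (tendsto_fst_mul_snd_atTop hv) hg hs

/-- A continuous function on `[0,∞]^m` that is at least `1` wherever some coordinate exceeds `ε`
after an earlier coordinate was at most `1 / n`. -/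
def upcrossing (m n : ℕ) {ε : ℝ≥0} (hε : ε ≠ 0) : C(Fin m → ℝ≥0∞, ℝ) where
  toFun z := ∑ i : Fin m, ∑ j ∈ Finset.Iic i,
    2 * ((1 + n * z j)⁻¹).toReal * (min 1 (z i / ε)).toReal
  continuous_toFun := by
    refine continuous_finsetSum _ fun i _ => continuous_finsetSum _ fun j _ =>
      (continuous_const.mul ?_).mul ?_
    · refine ENNReal.continuousOn_toReal.comp_continuous (continuous_inv.comp
        (continuous_const.add ((ENNReal.continuous_const_mul (ENNReal.natCast_ne_top n)).comp
          (continuous_apply j)))) fun z => ?_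
      simp
    · refine ENNReal.continuousOn_toReal.comp_continuous (continuous_const.min
        ((ENNReal.continuous_div_const ε (ENNReal.coe_ne_zero.2 hε)).comp
          (continuous_apply i))) fun z => ?_
      simp

theorem upcrossing_apply (m n : ℕ) {ε : ℝ≥0} (hε : ε ≠ 0) (z : Fin m → ℝ≥0∞) :
    upcrossing m n hε z =
    ∑ i : Fin m, ∑ j ∈ Finset.Iic i, 2 * ((1 + n * z j)⁻¹).toReal * (min 1 (z i / ε)).toReal :=
  rfl

theorem upcrossing_coe {m : ℕ} {ε : ℝ≥0} (hε : ε ≠ 0) (n : ℕ) (x : Fin m → ℝ≥0) :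
    upcrossing m n hε (fun i => (x i : ℝ≥0∞)) =
      ∑ i : Fin m, ∑ j ∈ Finset.Iic i, 2 * ((1 + n * x j)⁻¹ : ℝ) * min 1 (x i / ε : ℝ) := by
  rw [upcrossing_apply]
  refine Finset.sum_congr rfl fun i _ => Finset.sum_congr rfl fun j _ => ?_
  rw [← ENNReal.coe_div hε, ENNReal.toReal_inv, ENNReal.toReal_min (by simp) (by simp),
    ENNReal.toReal_add (by simp) (by finiteness)]
  simp

theorem measurable_upcrossing_coe {m : ℕ} {ε : ℝ≥0} (hε : ε ≠ 0) (n : ℕ) :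
    Measurable fun x : Fin m → ℝ≥0 => upcrossing m n hε (fun i => (x i : ℝ≥0∞)) :=
  (upcrossing m n hε).continuous.measurable.comp
    (measurable_pi_iff.2 fun i => (measurable_pi_apply i).coe_nnreal_ennreal)

theorem upcrossing_nonneg (m n : ℕ) {ε : ℝ≥0} (hε : ε ≠ 0) (z : Fin m → ℝ≥0∞) :
    0 ≤ upcrossing m n hε z := by
  rw [upcrossing_apply]
  positivity

theorem one_le_upcrossing {m n : ℕ} {ε : ℝ≥0} (hε : 0 < ε) {x : Fin m → ℝ≥0} {i j : Fin m}
    (hji : j ≤ i) (hj : n * x j ≤ 1) (hi : ε ≤ x i) :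
    1 ≤ upcrossing m n hε.ne' fun i => (x i : ℝ≥0∞) := by
  rw [upcrossing_coe hε.ne']
  have h1 : 1 ≤ 2 * ((1 + n * x j)⁻¹ : ℝ) * min 1 (x i / ε : ℝ) := by
    have hj' : (n * x j : ℝ) ≤ 1 := by exact_mod_cast hj
    rw [min_eq_left ((one_le_div (by exact_mod_cast hε)).2 (by exact_mod_cast hi)), mul_one,
      ← div_eq_mul_inv, one_le_div (by positivity)]
    linarith
  refine h1.trans ((Finset.single_le_sum (f := fun j => 2 * ((1 + n * x j)⁻¹ : ℝ) *
    min 1 (x i / ε : ℝ)) (fun _ _ => by positivity) (Finset.mem_Iic.2 hji)).trans ?_)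
  exact Finset.single_le_sum (f := fun i => ∑ j ∈ Finset.Iic i, 2 * ((1 + n * x j)⁻¹ : ℝ) *
    min 1 (x i / ε : ℝ)) (fun _ _ => by positivity) (Finset.mem_univ i)

theorem tendsto_integral_upcrossing (m : ℕ) {ε : ℝ≥0} (hε : 0 < ε) (u : ℝ≥0) :
    Tendsto (fun n => ∫ x, upcrossing m n hε.ne' (fun i => (x i : ℝ≥0∞)) ∂(tailChainLaw G m u)) atTop
      (𝓝 0) := by
  simp_rw [integral_tailChainLaw G m u (measurable_upcrossing_coe hε.ne' _), upcrossing_coe hε.ne']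
  rw [← integral_zero (Fin m → ℝ≥0) ℝ (μ := Measure.pi fun _ : Fin m => G)]
  refine tendsto_integral_of_dominated_convergence
    (fun _ => ∑ i : Fin m, ∑ j ∈ Finset.Iic i, 2) (fun n => ?_) (integrable_const _)
    (fun n => ae_of_all _ fun ξ => ?_) (ae_of_all _ fun ξ => ?_)
  · have := (measurable_upcrossing_coe (m := m) hε.ne' n).comp (measurable_tailChain m u)
    simp_rw [Function.comp_def, upcrossing_coe hε.ne'] at this
    exact this.aestronglyMeasurable
  · rw [Real.norm_eq_abs, abs_of_nonneg (by positivity)]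
    refine Finset.sum_le_sum fun i _ => Finset.sum_le_sum fun j _ => ?_
    rw [mul_assoc]
    refine mul_le_of_le_one_right zero_le_two (mul_le_one₀ (inv_le_one_of_one_le₀ ?_)
      (by positivity) (min_le_left _ _))
    exact le_add_of_nonneg_right (by positivity)
  · rw [show (0 : ℝ) = ∑ i : Fin m, ∑ j ∈ Finset.Iic i, 0 by simp]
    refine tendsto_finsetSum _ fun i _ => tendsto_finsetSum _ fun j hj => ?_
    rcases eq_or_ne (u * ∏ k ∈ Finset.Iic j, ξ k) 0 with h | h
    · have hi : u * ∏ k ∈ Finset.Iic i, ξ k = 0 := by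
        refine zero_dvd_iff.1 (h ▸ mul_dvd_mul_left u (Finset.prod_dvd_prod_of_subset _ _ _ ?_))
        exact Finset.Iic_subset_Iic.2 (Finset.mem_Iic.1 hj)
      simp [hi]
    · set c : ℝ := ((u * ∏ k ∈ Finset.Iic j, ξ k : ℝ≥0) : ℝ)
      have hc : 0 < c := by exact_mod_cast h.bot_lt
      have h1 : Tendsto (fun n : ℕ => (1 + n * c)⁻¹) atTop (𝓝 0) :=
        tendsto_inv_atTop_zero.comp (tendsto_atTop_add_const_left _ _
          (tendsto_natCast_atTop_atTop.atTop_mul_const hc))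
      simpa using (h1.const_mul 2).mul_const _

theorem exists_le_of_ecMap_ne {m : ℕ} {c x₀ : ℝ≥0} {x : Fin m → ℝ≥0} {i : Fin m} (hc : c < x₀)
    (h : ecMap m c x₀ x i ≠ x i) : ecMap m c x₀ x i = 0 ∧ ∃ j ≤ i, x j ≤ c := by
  unfold ecMap at h ⊢
  split_ifs at h ⊢ with hcond
  · exact absurd rfl h
  · refine ⟨rfl, ?_⟩
    by_contra! hcon
    exact hcond ⟨hc, hcon⟩

theorem tendsto_measure_ecMap {γ ut : ℝ≥0 → ℝ≥0} {u : ℝ≥0} (hu : 0 < u)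
    (hγ : Tendsto γ atTop (𝓝 0)) (hut : Tendsto ut atTop (𝓝 u)) {m : ℕ}
    (hconv : ∀ f : C((Fin m → ℝ≥0∞), ℝ),
      Tendsto (fun t : ℝ≥0 =>
          ∫ x, f (fun i => ((x i / t : ℝ≥0) : ℝ≥0∞)) ∂(jointLaw K m (t * ut t)))
        atTop (𝓝 (∫ x, f (fun i => (x i : ℝ≥0∞)) ∂(tailChainLaw G m u))))
    {ε : ℝ} (hε : 0 < ε) :
    Tendsto (fun t : ℝ≥0 => (jointLaw K m (t * ut t)) {x | ∃ i : Fin m,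
        ε < |((ecMap m (t * γ t) (t * ut t) x i : ℝ) / t - (x i : ℝ) / t)|}) atTop (𝓝 0) := by
  lift ε to ℝ≥0 using hε.le
  replace hε : 0 < ε := by exact_mod_cast hε
  suffices Tendsto (fun t : ℝ≥0 => (jointLaw K m (t * ut t)).real {x | ∃ i : Fin m,
      (ε : ℝ) < |((ecMap m (t * γ t) (t * ut t) x i : ℝ) / t - (x i : ℝ) / t)|}) atTop (𝓝 0) by
    rw [← ENNReal.tendsto_toReal_iff (fun _ => measure_ne_top _ _) ENNReal.zero_ne_top]
    exact this
  rw [Metric.tendsto_nhds]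
  intro η hη
  obtain ⟨n, hn⟩ := ((tendsto_integral_upcrossing (G := G) m hε u).eventually
    (gt_mem_nhds hη)).exists
  have hγn : ∀ᶠ t in atTop, n * γ t < 1 := by
    have : Tendsto (fun t => n * γ t) atTop (𝓝 (n * 0)) := hγ.const_mul _
    rw [mul_zero] at this
    exact this.eventually (gt_mem_nhds one_pos)
  filter_upwards [(hconv (upcrossing m n hε.ne')).eventually (gt_mem_nhds hn), hγn,
    hγ.eventually_lt hut hu, eventually_gt_atTop 0] with t h1 h2 h3 ht
  rw [Real.dist_eq, sub_zero, abs_of_nonneg measureReal_nonneg]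
  refine lt_of_le_of_lt ?_ h1
  have hint : Integrable (fun x : Fin m → ℝ≥0 => upcrossing m n hε.ne'
      fun i => ((x i / t : ℝ≥0) : ℝ≥0∞)) (jointLaw K m (t * ut t)) :=
    Integrable.of_bound ((upcrossing m n hε.ne').continuous.measurable.comp
      (measurable_coe_div m t)).aestronglyMeasurable _
      (ae_of_all _ fun x => (upcrossing m n hε.ne').norm_coe_le_norm _)
  have hmarkov := mul_meas_ge_le_integral_of_nonneg
    (ae_of_all _ fun x => upcrossing_nonneg m n hε.ne' _) hint 1
  rw [one_mul] at hmarkov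
  refine (measureReal_mono fun x hx => ?_).trans hmarkov
  obtain ⟨i, hi⟩ := hx
  have hne : ecMap m (t * γ t) (t * ut t) x i ≠ x i := fun h => by
    rw [h, sub_self, abs_zero] at hi
    exact absurd hi (not_lt.2 ε.2)
  obtain ⟨h0, j, hji, hj⟩ := exists_le_of_ecMap_ne (mul_lt_mul_of_pos_left h3 ht) hne
  refine one_le_upcrossing hε (x := fun i => x i / t) hji ?_ ?_
  · rw [← mul_div_assoc, div_le_one ht]
    calc n * x j ≤ n * (t * γ t) := by gcongr
      _ = t * (n * γ t) := by ring
      _ ≤ t := mul_le_of_le_one_right zero_le h2.le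
  · rw [h0, NNReal.coe_zero, zero_div, zero_sub, abs_neg, abs_of_nonneg (by positivity)] at hi
    exact_mod_cast hi.le

end ExtremalComponent

/-- If `γ ≡ 0` is an extremal boundary for `K ∈ D(G)`, or `K` satisfies the regularity
condition, then (for `u_t → u > 0`) the scaled extremal component and the scaled chain
are asymptotically indistinguishable in the sup-metric `ρ`, and consequently the
conditional laws of `(X_1/t, …, X_m/t)` converge weakly on `[0,∞]^m` to those of the
tail chain `(T*_1, …, T*_m)` started from `u`. -/
theorem regularity_extremal_component_equiv (K : Kernel ℝ≥0 ℝ≥0) [IsMarkovKernel K]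
    (G : Measure ℝ≥0) [IsProbabilityMeasure G] (hK : KernelDOA K G)
    (γ : ℝ≥0 → ℝ≥0) (hγ : UniformExtremalBoundary K G γ)
    (m : ℕ) (hm : 1 ≤ m)
    (hcase : ExtremalBoundary K G (fun _ => 0) ∨ RegCond K)
    (u : ℝ≥0) (hu : 0 < u) (ut : ℝ≥0 → ℝ≥0) (hut : Tendsto ut atTop (𝓝 u)) :
    (∀ ε : ℝ, 0 < ε →
      Tendsto (fun t : ℝ≥0 =>
          (jointLaw K m (t * ut t)) {x | ∃ i : Fin m,
            ε < |((ecMap m (t * γ t) (t * ut t) x i : ℝ) / t - (x i : ℝ) / t)|})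
        atTop (𝓝 0)) ∧
    (∀ f : C((Fin m → ℝ≥0∞), ℝ),
      Tendsto (fun t : ℝ≥0 =>
          ∫ x, f (fun i => ((x i / t : ℝ≥0) : ℝ≥0∞)) ∂(jointLaw K m (t * ut t)))
        atTop
        (𝓝 (∫ x, f (fun i => (x i : ℝ≥0∞)) ∂(tailChainLaw G m u)))) := by
  have hconv : ∀ f : C((Fin m → ℝ≥0∞), ℝ), Tendsto (fun p : ℝ≥0 × ℝ≥0 =>
      ∫ x, f (fun i => ((x i / p.1 : ℝ≥0) : ℝ≥0∞)) ∂(jointLaw K m (p.1 * p.2)))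
      (atTop ×ˢ 𝓝 u) (𝓝 (∫ x, f (fun i => (x i : ℝ≥0∞)) ∂(tailChainLaw G m u))) := fun f =>
    hcase.elim (fun h => tendsto_integral_jointLaw_of_extremalBoundary_zero hK h hu f)
      fun h => tendsto_integral_jointLaw_of_regCond hK h hu f
  have hweak : ∀ f : C((Fin m → ℝ≥0∞), ℝ), Tendsto (fun t : ℝ≥0 =>
      ∫ x, f (fun i => ((x i / t : ℝ≥0) : ℝ≥0∞)) ∂(jointLaw K m (t * ut t)))
      atTop (𝓝 (∫ x, f (fun i => (x i : ℝ≥0∞)) ∂(tailChainLaw G m u))) := fun f =>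
    (hconv f).comp (tendsto_id.prodMk hut)
  exact ⟨fun ε hε => tendsto_measure_ecMap hu hγ.1 hut hweak hε, hweak⟩
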